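/- arXiv:1012.2681 — 2 statements merged into one kernel-verified Lean document; each statement's English description precedes it below -/
import Mathlib

section
/- The pair (F, G) defined by F(n,k) = A(n,k)·(−1)^n·(16/9)^n / n! and G(n,k) = B(n,k)·(−1)^n·(16/9)^n / n!, where A(n,k) = U(n,k)·(−n(n−2))/(3(n+2k+1)), B(n,k) = U(n,k)·(5n+6k+1), and U(n,k) = [(1/2)_n (1/4+3k/2)_n (3/4+3k/2)_n / ((1+k)_n (1+2k)_n)] · [(1/6)_k (5/6)_k / ((1)_k)^2], is a WZ-pair; that is, for all natural numbers n and k, F(n+1,k) − F(n,k) = G(n,k+1) − G(n,k). -/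
/-- Rising factorial (Pochhammer symbol) `(a)ₙ = a(a+1)⋯(a+n−1)`. -/
noncomputable def pochR (a : ℝ) (n : ℕ) : ℝ := ∏ i ∈ Finset.range n, (a + i)

noncomputable def U0 (n k : ℕ) : ℝ :=
  (pochR (1/2) n * pochR (1/4 + 3*k/2) n * pochR (3/4 + 3*k/2) n /
    (pochR (1 + k) n * pochR (1 + 2*k) n)) *
  (pochR (1/6) k * pochR (5/6) k / (pochR 1 k)^2)

noncomputable def A0 (n k : ℕ) : ℝ :=
  U0 n k * (-(n : ℝ) * ((n : ℝ) - 2)) / (3 * ((n : ℝ) + 2*k + 1))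

noncomputable def B0 (n k : ℕ) : ℝ :=
  U0 n k * (5*(n : ℝ) + 6*k + 1)

noncomputable def F0 (n k : ℕ) : ℝ :=
  A0 n k * (-1)^n * (16/9)^n / (n.factorial : ℝ)

noncomputable def G0 (n k : ℕ) : ℝ :=
  B0 n k * (-1)^n * (16/9)^n / (n.factorial : ℝ)

theorem pochR_succ (a : ℝ) (n : ℕ) : pochR a (n+1) = pochR a n * (a + n) := by
  simp [pochR, Finset.prod_range_succ]

theorem pochR_shift (a : ℝ) (n : ℕ) (ha : 0 < a) :
    pochR (a+1) n = pochR a n * (a + n) / a := by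
  induction n with
  | zero => simp [pochR, ha.ne']
  | succ n ih =>
    rw [pochR_succ, ih, pochR_succ]
    push_cast
    field_simp
    ring

theorem pochR_pos (a : ℝ) (n : ℕ) (ha : 0 < a) : 0 < pochR a n := by
  unfold pochR
  exact Finset.prod_pos fun i _ => by positivity

theorem U0_succ_left (n k : ℕ) : U0 (n+1) k = U0 n k *
    ((1/2 + n) * (1/4 + 3*k/2 + n) * (3/4 + 3*k/2 + n) / ((1 + k + n) * (1 + 2*k + n))) := by
  have h1 := (pochR_pos (1 + k) n (by positivity)).ne'
  have h2 := (pochR_pos (1 + 2*k) n (by positivity)).ne'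
  have h3 := (pochR_pos 1 k (by positivity)).ne'
  unfold U0
  simp only [pochR_succ]
  field_simp

theorem U0_succ_right (n k : ℕ) : U0 n (k+1) = U0 n k *
    (((3/4 + 3*k/2 + n) / (3/4 + 3*k/2) *
      ((1/4 + 3*k/2 + n) * (1/4 + 3*k/2 + 1 + n) / ((1/4 + 3*k/2) * (1/4 + 3*k/2 + 1)))) /
     ((1 + k + n) / (1 + k) *
      ((1 + 2*k + n) * (1 + 2*k + 1 + n) / ((1 + 2*k) * (1 + 2*k + 1)))) *
     ((1/6 + k) * (5/6 + k) / (1 + k)^2)) := by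
  have h1 := (pochR_pos (1 + k) n (by positivity)).ne'
  have h2 := (pochR_pos (1 + 2*k) n (by positivity)).ne'
  have h3 := (pochR_pos 1 k (by positivity)).ne'
  have e1 : (1/4 + 3*((k+1 : ℕ) : ℝ)/2) = (3/4 + 3*k/2) + 1 := by push_cast; ring
  have e2 : (3/4 + 3*((k+1 : ℕ) : ℝ)/2) = ((1/4 + 3*k/2) + 1) + 1 := by push_cast; ring
  have e3 : (1 + ((k+1 : ℕ) : ℝ)) = (1 + k) + 1 := by push_cast; ring
  have e4 : (1 + 2*((k+1 : ℕ) : ℝ)) = ((1 + 2*k) + 1) + 1 := by push_cast; ring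
  unfold U0
  rw [e1, e2, e3, e4, pochR_shift _ n (show (0:ℝ) < 3/4 + 3*k/2 by positivity),
    pochR_shift _ n (show (0:ℝ) < 1/4 + 3*k/2 + 1 by positivity),
    pochR_shift _ n (show (0:ℝ) < 1/4 + 3*k/2 by positivity),
    pochR_shift _ n (show (0:ℝ) < 1 + k by positivity),
    pochR_shift _ n (show (0:ℝ) < 1 + 2*k + 1 by positivity),
    pochR_shift _ n (show (0:ℝ) < 1 + 2*k by positivity)]
  simp only [pochR_succ]
  generalize pochR (1/2) n = p1
  generalize pochR (1/4 + 3*k/2) n = p2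
  generalize pochR (3/4 + 3*k/2) n = p3
  generalize pochR (1/6) k = p4
  generalize pochR (5/6) k = p5
  generalize pochR (1 + k) n = q1 at *
  generalize pochR (1 + 2*k) n = q2 at *
  generalize pochR 1 k = q3 at *
  field_simp

/-- `(F₀, G₀)` is a WZ-pair. -/
theorem wz_pair_divergent_16_9 :
    ∀ n k : ℕ, F0 (n+1) k - F0 n k = G0 n (k+1) - G0 n k := by
  intro n k
  unfold F0 G0 A0 B0
  rw [U0_succ_left, U0_succ_right, Nat.factorial_succ, pow_succ, pow_succ]
  have hf : (n.factorial : ℝ) ≠ 0 := by positivity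
  generalize U0 n k = u
  push_cast
  generalize (n.factorial : ℝ) = f at *
  generalize ((-1 : ℝ))^n = s
  generalize ((16/9 : ℝ))^n = z
  generalize hx : (n : ℝ) = x
  generalize hy : (k : ℝ) = y
  have hx0 : 0 ≤ x := hx ▸ n.cast_nonneg
  have hy0 : 0 ≤ y := hy ▸ k.cast_nonneg
  field_simp
  ring
end

section
/- For every real c with −1/4 < c < 0, the function y ↦ g(c+iy) is integrable over ℝ and (1/(2π)) ∫_{−∞}^{∞} g(c+iy) dy = √3/π, where g(s) = [(1/2)_s (1/4)_s (3/4)_s / ((1)_s)^2] · (5s+1) · Γ(−s) · (4/3)^{2s}. -/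
open Complex MeasureTheory Real

/-- Complex rising factorial `(a)ₛ = Γ(a+s)/Γ(a)`. -/
noncomputable def cpoch (a s : ℂ) : ℂ := Complex.Gamma (a + s) / Complex.Gamma a

/-- Complex power of a positive real base: `b^s = exp(s · log b)` with the real logarithm. -/
noncomputable def cpowR (b : ℝ) (s : ℂ) : ℂ := Complex.exp (s * (Real.log b : ℂ))

/-- The integrand `g`. -/
noncomputable def g2 (s : ℂ) : ℂ :=
  (cpoch (1/2) s * cpoch (1/4) s * cpoch (3/4) s / (cpoch 1 s)^2) *
    (5*s + 1) * Complex.Gamma (-s) * cpowR (4/3) (2*s)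


noncomputable def kap (y : ℝ) : ℝ := (√(Real.cosh (π * y)))⁻¹

lemma kap_pos (y : ℝ) : 0 < kap y := by
  unfold kap
  have := Real.cosh_pos (π * y)
  positivity

lemma norm_beta_le (z : ℂ) (v : ℝ) (hz : 0 < z.re) (hv : 0 < v) :
    ‖Complex.betaIntegral z v‖ ≤ Real.Gamma z.re * Real.Gamma v / Real.Gamma (z.re + v) := by
  have e : (Complex.betaIntegral (z.re : ℂ) v) =
      ((Real.Gamma z.re * Real.Gamma v / Real.Gamma (z.re + v) : ℝ) : ℂ) := by
    rw [Complex.betaIntegral_eq_Gamma_mul_div _ _ (by simpa using hz) (by simpa using hv)]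
    push_cast [← Complex.Gamma_ofReal]
    rfl
  have hpt : ∀ x ∈ Set.Ioo (0:ℝ) 1, ((x : ℂ) ^ ((z.re : ℂ) - 1) * (1 - (x : ℂ)) ^ ((v : ℂ) - 1))
      = ((x ^ (z.re - 1) * (1 - x) ^ (v - 1) : ℝ) : ℂ) := by
    intro x hx
    push_cast
    rw [Complex.ofReal_cpow hx.1.le, Complex.ofReal_cpow (by linarith [hx.2])]
    push_cast; rfl
  have e2 : (Complex.betaIntegral (z.re : ℂ) v) =
      ((∫ x in (0:ℝ)..1, x ^ (z.re - 1) * (1 - x) ^ (v - 1) : ℝ) : ℂ) := by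
    unfold Complex.betaIntegral
    rw [← intervalIntegral.integral_ofReal]
    rw [intervalIntegral.integral_of_le zero_le_one, intervalIntegral.integral_of_le zero_le_one,
      integral_Ioc_eq_integral_Ioo, integral_Ioc_eq_integral_Ioo]
    exact setIntegral_congr_fun measurableSet_Ioo hpt
  have e3 : (∫ x in (0:ℝ)..1, x ^ (z.re - 1) * (1 - x) ^ (v - 1) : ℝ)
      = Real.Gamma z.re * Real.Gamma v / Real.Gamma (z.re + v) := by
    exact_mod_cast e2.symm.trans e
  rw [← e3]
  unfold Complex.betaIntegral
  refine (intervalIntegral.norm_integral_le_integral_norm zero_le_one).trans (le_of_eq ?_)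
  rw [intervalIntegral.integral_of_le zero_le_one, intervalIntegral.integral_of_le zero_le_one,
      integral_Ioc_eq_integral_Ioo, integral_Ioc_eq_integral_Ioo]
  refine setIntegral_congr_fun measurableSet_Ioo ?_
  intro x hx
  have h1 : (0:ℝ) < 1 - x := by linarith [hx.2]
  have : (1 - (x:ℂ)) = ((1 - x : ℝ) : ℂ) := by push_cast; rfl
  simp only [norm_mul]
  rw [this, Complex.norm_cpow_eq_rpow_re_of_pos hx.1, Complex.norm_cpow_eq_rpow_re_of_pos h1]
  simp

lemma gamma_mono (z : ℂ) (v : ℝ) (hz : 0 < z.re) (hv : 0 ≤ v) :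
    ‖Complex.Gamma z‖ * Real.Gamma (z.re + v) ≤ Real.Gamma z.re * ‖Complex.Gamma (z + v)‖ := by
  rcases hv.eq_or_lt with rfl | hv
  · simp [mul_comm]
  have h := Complex.Gamma_mul_Gamma_eq_betaIntegral hz (t := (v:ℂ)) (by simpa using hv)
  have hb := norm_beta_le z v hz hv
  have gv := Real.Gamma_pos_of_pos hv
  have gxv := Real.Gamma_pos_of_pos (add_pos hz hv)
  have h2 := congrArg norm h
  rw [norm_mul, norm_mul, Complex.Gamma_ofReal, Complex.norm_real, Real.norm_of_nonneg gv.le] at h2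
  rw [le_div_iff₀ gxv] at hb
  have h3 : ‖Complex.Gamma (z+v)‖ * (‖Complex.betaIntegral z v‖ * Real.Gamma (z.re + v)) ≤
    ‖Complex.Gamma (z+v)‖ * (Real.Gamma z.re * Real.Gamma v) := by gcongr
  rw [← mul_assoc, ← h2] at h3
  nlinarith

lemma gamma_half (y : ℝ) : ‖Complex.Gamma (1/2 + y * I)‖ = √π * kap y := by
  have h := Complex.Gamma_mul_Gamma_one_sub (1/2 + y * I)
  have h1 : (1 - (1/2 + (y:ℂ) * I)) = (starRingEnd ℂ) (1/2 + y * I) := by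
    apply Complex.ext <;> simp <;> norm_num
  have h2 : Complex.sin (π * (1/2 + y * I)) = (Real.cosh (π * y) : ℝ) := by
    rw [show (π * (1/2 + y * I) : ℂ) = (π * y : ℝ) * I + π / 2 by push_cast; ring,
      Complex.sin_add_pi_div_two, Complex.cos_mul_I, Complex.ofReal_cosh]
  rw [h1, Complex.Gamma_conj, Complex.mul_conj, h2, Complex.normSq_eq_norm_sq] at h
  have h3 : ‖Complex.Gamma (1/2 + y * I)‖ ^ 2 = π / Real.cosh (π * y) := by exact_mod_cast h
  have := Real.cosh_pos (π * y)
  rw [← Real.sqrt_sq (norm_nonneg (Complex.Gamma (1/2 + y * I))), h3, kap,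
    Real.sqrt_div pi_pos.le, div_eq_mul_inv]

lemma sqrt_pi_pos : 0 < √π := Real.sqrt_pos.mpr pi_pos

/-- lower bound -/
lemma gamma_lower (z : ℂ) (hz : 1/2 ≤ z.re) : Real.Gamma z.re * kap z.im ≤ ‖Complex.Gamma z‖ := by
  have h := gamma_mono (1/2 + z.im * I) (z.re - 1/2) (by simp) (by linarith)
  have e : (1/2 + z.im * I + ((z.re - 1/2 : ℝ) : ℂ)) = z := by
    apply Complex.ext <;> simp
  have e2 : (1/2 + (z.im:ℂ) * I).re = 1/2 := by simp
  rw [e, e2, gamma_half, Real.Gamma_one_half_eq] at h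
  ring_nf at h ⊢
  nlinarith [sqrt_pi_pos]

lemma gamma_upper0 (z : ℂ) (hz0 : 0 < z.re) (hz : z.re ≤ 1/2) :
    ‖Complex.Gamma z‖ ≤ Real.Gamma z.re * kap z.im := by
  have h := gamma_mono z (1/2 - z.re) hz0 (by linarith)
  have e : (z + ((1/2 - z.re : ℝ) : ℂ)) = 1/2 + z.im * I := by
    apply Complex.ext <;> simp
  rw [e, gamma_half, show z.re + (1/2 - z.re) = 1/2 by ring, Real.Gamma_one_half_eq] at h
  nlinarith [sqrt_pi_pos]

lemma gamma_upper1 (z : ℂ) (hz0 : 0 < z.re) (hz : z.re ≤ 3/2) :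
    ‖Complex.Gamma z‖ ≤ Real.Gamma z.re * ((1 + 2 * |z.im|) * kap z.im) := by
  have h := gamma_mono z (3/2 - z.re) hz0 (by linarith)
  have e : (z + ((3/2 - z.re : ℝ) : ℂ)) = (1/2 + z.im * I) + 1 := by
    apply Complex.ext <;> simp
    norm_num
  have hne : (1/2 + z.im * I : ℂ) ≠ 0 := by
    intro h; have := congrArg Complex.re h; simp at this
  rw [e, Complex.Gamma_add_one _ hne, norm_mul, gamma_half,
    show z.re + (3/2 - z.re) = 1/2 + 1 by ring, Real.Gamma_add_one (by norm_num),
    Real.Gamma_one_half_eq] at h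
  have h3 : ‖(1/2 + z.im * I : ℂ)‖ ≤ 1/2 + |z.im| := by
    refine (norm_add_le _ _).trans ?_
    simp
  have h4 : Real.Gamma z.re * (‖(1/2 + z.im * I : ℂ)‖ * (√π * kap z.im)) ≤
     Real.Gamma z.re * ((1/2 + |z.im|) * (√π * kap z.im)) := by
    have := kap_pos z.im
    have := Real.Gamma_pos_of_pos hz0
    gcongr
  have h5 := h.trans h4
  have : √π * (‖Complex.Gamma z‖) ≤ √π * (Real.Gamma z.re * ((1 + 2 * |z.im|) * kap z.im)) := by
    linarith
  exact le_of_mul_le_mul_left this sqrt_pi_pos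

lemma gamma_upper (z : ℂ) (hz0 : 0 < z.re) : ‖Complex.Gamma z‖ ≤ Real.Gamma z.re := by
  rw [Complex.Gamma_eq_integral hz0, Real.Gamma_eq_integral hz0]
  unfold Complex.GammaIntegral
  refine (norm_integral_le_integral_norm _).trans (le_of_eq ?_)
  refine setIntegral_congr_fun measurableSet_Ioi ?_
  intro x hx
  simp only [norm_mul]
  rw [Complex.norm_cpow_eq_rpow_re_of_pos hx, Complex.norm_real, Real.norm_of_nonneg (Real.exp_pos _).le]
  simp

noncomputable def HH (m : ℕ) (t : ℂ) : ℂ :=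
  Complex.Gamma (2 * t + 1/2 + 3 * m) / (Complex.Gamma (t + 1 + m) * Complex.Gamma (t + 1 + 2 * m))

noncomputable def HR (m : ℕ) (x : ℝ) : ℝ :=
  Real.Gamma (2 * x + 1/2 + 3 * m) / (Real.Gamma (x + 1 + m) * Real.Gamma (x + 1 + 2 * m))

lemma HH_ofReal (m : ℕ) (x : ℝ) : HH m x = (HR m x : ℝ) := by
  unfold HH HR
  push_cast [← Complex.Gamma_ofReal]
  rfl

lemma HR_pos (m : ℕ) (x : ℝ) (hx : -1/4 < x) : 0 < HR m x := by
  have hm : (0:ℝ) ≤ m := Nat.cast_nonneg m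
  have h1 := Real.Gamma_pos_of_pos (s := 2 * x + 1/2 + 3 * m) (by linarith)
  have h2 := Real.Gamma_pos_of_pos (s := x + 1 + m) (by linarith)
  have h3 := Real.Gamma_pos_of_pos (s := x + 1 + 2 * m) (by linarith)
  unfold HR
  positivity

lemma HH_bound (m : ℕ) (t : ℂ) (ht : -1/4 < t.re) : ‖HH m t‖ * kap t.im ≤ HR m t.re := by
  have hm : (0:ℝ) ≤ m := Nat.cast_nonneg m
  set x := t.re with hx
  set a : ℂ := t + 1/4 + 3/2 * m with ha
  have hare : a.re = x + 1/4 + 3/2 * m := by simp [ha, hx]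
  have k := kap_pos t.im
  have dup := Complex.Gamma_mul_Gamma_add_half a
  have dupR := Real.Gamma_mul_Gamma_add_half (x + 1/4 + 3/2 * m)
  rw [show 2 * a = 2 * t + 1/2 + 3 * m by rw [ha]; ring] at dup
  rw [show 2 * (x + 1/4 + 3/2 * m) = 2 * x + 1/2 + 3 * m by ring] at dupR
  have b1 := gamma_upper a (by rw [hare]; linarith)
  have b2 := gamma_mono (a + 1/2) (m/2 + 1/4) (by simp [hare]; linarith) (by positivity)
  have b3 := gamma_lower (t + 1 + m) (by simp; linarith)
  rw [show (a + 1/2 + ((m/2 + 1/4 : ℝ) : ℂ)) = t + 1 + 2 * m by rw [ha]; push_cast; ring,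
    show (a + 1/2).re = x + 1/4 + 3/2 * m + 1/2 by simp [hare],
    show x + 1/4 + 3/2 * m + 1/2 + ((m:ℝ)/2+1/4) = x + 1 + 2 * m by ring] at b2
  rw [show (t + 1 + m).re = x + 1 + m by simp [hx], show (t + 1 + m).im = t.im by simp] at b3
  rw [hare] at b1
  have gA := Real.Gamma_pos_of_pos (s := x + 1/4 + 3/2 * m) (by linarith)
  have gB := Real.Gamma_pos_of_pos (s := x + 1/4 + 3/2 * m + 1/2) (by linarith)
  have g2 := Real.Gamma_pos_of_pos (s := x + 1 + m) (by linarith)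
  have g3 := Real.Gamma_pos_of_pos (s := x + 1 + 2 * m) (by linarith)
  have n2 : 0 < ‖Complex.Gamma (t + 1 + m)‖ := lt_of_lt_of_le (by positivity) b3
  have n3 : 0 < ‖Complex.Gamma (t + 1 + 2 * m)‖ := by
    rw [norm_pos_iff]; apply Complex.Gamma_ne_zero_of_re_pos; simp; linarith
  have P : 0 < (2:ℝ) ^ (1 - (2 * x + 1/2 + 3 * m)) * √π := by
    have := sqrt_pi_pos
    positivity
  have n2c : ∀ w : ℂ, ‖(2:ℂ) ^ w‖ = (2:ℝ) ^ w.re := by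
    intro w
    have := Complex.norm_cpow_eq_rpow_re_of_pos (x := 2) (by norm_num) w
    simpa using this
  have dn := congrArg norm dup
  rw [norm_mul, norm_mul, norm_mul, mul_assoc, Complex.norm_real, Real.norm_of_nonneg sqrt_pi_pos.le,
    n2c] at dn
  rw [show (1 - (2 * t + 1/2 + 3 * m) : ℂ).re = 1 - (2 * x + 1/2 + 3 * m) by
    simp [hx]] at dn
  rw [mul_assoc] at dupR
  set Q := (2:ℝ) ^ (1 - (2 * x + 1/2 + 3 * m)) * √π
  unfold HH HR
  rw [norm_div, norm_mul, div_mul_eq_mul_div, div_le_div_iff₀ (by positivity) (by positivity)]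
  apply le_of_mul_le_mul_right _ P
  calc _ = (‖Complex.Gamma a‖ * ‖Complex.Gamma (a + 1/2)‖) * kap t.im *
        (Real.Gamma (x + 1 + m) * Real.Gamma (x + 1 + 2 * m)) := by rw [dn]; ring
    _ = ‖Complex.Gamma a‖ * (‖Complex.Gamma (a + 1/2)‖ * Real.Gamma (x + 1 + 2 * m)) *
        (Real.Gamma (x + 1 + m) * kap t.im) := by ring
    _ ≤ Real.Gamma (x + 1/4 + 3/2 * m) * (Real.Gamma (x + 1/4 + 3/2 * m + 1/2)
         * ‖Complex.Gamma (t + 1 + 2 * m)‖) * ‖Complex.Gamma (t + 1 + m)‖ := by gcongr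
    _ = _ := by
      rw [show ∀ A B C D : ℝ, A * (B * C) * D = (A * B) * (C * D) by intros; ring, dupR]
      ring

lemma cpowR_norm (b : ℝ) (s : ℂ) : ‖cpowR b s‖ = Real.exp (s.re * Real.log b) := by
  unfold cpowR
  rw [Complex.norm_exp]
  simp

lemma cpowR_add_one (b : ℝ) (hb : 0 < b) (s : ℂ) : cpowR b (s + 1) = b * cpowR b s := by
  unfold cpowR
  rw [add_mul, Complex.exp_add, one_mul, ← Complex.ofReal_exp, Real.exp_log hb, mul_comm]

lemma cpowR_differentiable (b : ℝ) : Differentiable ℂ (cpowR b) := by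
  unfold cpowR
  fun_prop

noncomputable def FF (m : ℕ) (t : ℂ) : ℂ :=
  Complex.Gamma (t + 1/2) * Complex.Gamma (-t) * HH m t * cpowR (4/9) t * (4/27) ^ m
    * (5 * t + 1 + 6 * m)

noncomputable def GG (m : ℕ) (t : ℂ) : ℂ :=
  Complex.Gamma (t + 1/2) * Complex.Gamma (1 - t) * HH m t / (t + 1 + 2 * m) * cpowR (4/9) t
    * (4/27) ^ m * ((t - 2) / 3)

lemma re_ne {z : ℂ} (h : 0 < z.re) : z ≠ 0 := by
  intro h0; rw [h0] at h; simp at h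

lemma wz (m : ℕ) (t : ℂ) (h1 : -1/4 < t.re) (h2 : t.re < 0) :
    FF (m+1) t - FF m t = GG m (t + 1) - GG m t := by
  have hm : (0:ℝ) ≤ m := Nat.cast_nonneg m
  have ha : (2 * t + 1/2 + 3 * m) ≠ 0 := re_ne (by simp; linarith)
  have ha1 : (2 * t + 1/2 + 3 * m) + 1 ≠ 0 := re_ne (by simp; linarith)
  have ha2 : (2 * t + 1/2 + 3 * m) + 1 + 1 ≠ 0 := re_ne (by simp; linarith)
  have hb : (t + 1 + m) ≠ 0 := re_ne (by simp; linarith)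
  have hc : (t + 1 + 2 * m) ≠ 0 := re_ne (by simp; linarith)
  have hc1 : (t + 1 + 2 * m) + 1 ≠ 0 := re_ne (by simp; linarith)
  have hd : t + 1/2 ≠ 0 := re_ne (by simp; linarith)
  have he : -t ≠ 0 := re_ne (by simp; linarith)
  have gB : Complex.Gamma (t + 1 + m) ≠ 0 :=
    Complex.Gamma_ne_zero_of_re_pos (by simp; linarith)
  have gC : Complex.Gamma (t + 1 + 2 * m) ≠ 0 :=
    Complex.Gamma_ne_zero_of_re_pos (by simp; linarith)
  unfold FF GG HH
  push_cast
  rw [cpowR_add_one _ (by norm_num)]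
  rw [show 2 * t + 1/2 + 3 * ((m:ℂ) + 1) = (2 * t + 1/2 + 3 * m) + 1 + 1 + 1 by ring,
    show 2 * (t + 1) + 1/2 + 3 * (m:ℂ) = (2 * t + 1/2 + 3 * m) + 1 + 1 by ring,
    show t + 1 + ((m:ℂ) + 1) = (t + 1 + m) + 1 by ring,
    show t + 1 + 1 + (m:ℂ) = (t + 1 + m) + 1 by ring,
    show t + 1 + 2 * ((m:ℂ) + 1) = (t + 1 + 2 * m) + 1 + 1 by ring,
    show t + 1 + 1 + 2 * (m:ℂ) = (t + 1 + 2 * m) + 1 by ring,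
    show t + 1 + 1/2 = (t + 1/2) + 1 by ring,
    show 1 - (t + 1) = -t by ring, show 1 - t = -t + 1 by ring,
    Complex.Gamma_add_one _ ha2, Complex.Gamma_add_one _ ha1, Complex.Gamma_add_one _ ha,
    Complex.Gamma_add_one _ hb, Complex.Gamma_add_one _ hc1, Complex.Gamma_add_one _ hc,
    Complex.Gamma_add_one _ hd, Complex.Gamma_add_one _ he, pow_succ]
  push_cast
  generalize Complex.Gamma (2 * t + 1/2 + 3 * m) = A
  generalize Complex.Gamma (t + 1 + m) = B at *
  generalize Complex.Gamma (t + 1 + 2 * m) = C at *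
  generalize Complex.Gamma (t + 1/2) = D
  generalize Complex.Gamma (-t) = E
  generalize cpowR (4/9) t = Z
  generalize ((4:ℂ)/27) ^ m = W
  field_simp
  ring

lemma kap_le (y : ℝ) : kap y * (1 + 2 * |y|) ^ 3 ≤ 3456 * Real.exp (-|y|) := by
  have h1 : Real.exp (3 * |y|) / 4 ≤ Real.cosh (π * y) := by
    rw [← Real.cosh_abs, Real.cosh_eq, abs_mul, abs_of_pos pi_pos]
    have : Real.exp (3 * |y|) ≤ Real.exp (π * |y|) := by
      apply Real.exp_le_exp.mpr
      have := pi_gt_three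
      gcongr
    have := Real.exp_pos (-(π * |y|))
    have := Real.exp_pos (3 * |y|)
    linarith
  have h2 : Real.exp (3/2 * |y|) / 2 ≤ √(Real.cosh (π * y)) := by
    apply Real.le_sqrt_of_sq_le
    convert h1 using 1
    rw [div_pow, ← Real.exp_nat_mul]
    ring_nf
  have h3 : kap y ≤ 2 * Real.exp (-(3/2 * |y|)) := by
    unfold kap
    rw [Real.exp_neg]
    have := Real.exp_pos (3/2 * |y|)
    calc _ ≤ (Real.exp (3/2 * |y|) / 2)⁻¹ := by gcongr
      _ = _ := by field_simp
  have h4 : 1 + 2 * |y| ≤ 12 * Real.exp (|y| / 6) := by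
    have := Real.add_one_le_exp (|y| / 6)
    have := abs_nonneg y
    linarith
  have := abs_nonneg y
  calc kap y * (1 + 2 * |y|) ^ 3 ≤ (2 * Real.exp (-(3/2 * |y|))) * (12 * Real.exp (|y| / 6)) ^ 3 := by
        gcongr
    _ = 3456 * (Real.exp (-(3/2 * |y|)) * Real.exp (|y| / 6) ^ 3) := by ring
    _ = _ := by
        rw [← Real.exp_nat_mul, ← Real.exp_add]; congr 2; push_cast; ring

lemma integrable_expabs : Integrable (fun y : ℝ => Real.exp (-|y|)) := by
  rw [← integrableOn_univ, ← Set.Iic_union_Ioi (a := (0:ℝ)), integrableOn_union]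
  constructor
  · refine (integrableOn_exp_Iic 0).congr_fun ?_ measurableSet_Iic
    intro x hx
    simp [abs_of_nonpos (show x ≤ 0 from hx)]
  · refine (integrableOn_exp_neg_Ioi 0).congr_fun ?_ measurableSet_Ioi
    intro x hx
    simp [abs_of_pos (show 0 < x from hx)]

lemma shift (f : ℂ → ℂ) (a C : ℝ) (hd : ∀ z : ℂ, a ≤ z.re → z.re ≤ a + 1 → DifferentiableAt ℂ f z)
    (hb : ∀ z : ℂ, a ≤ z.re → z.re ≤ a + 1 → ‖f z‖ ≤ C * Real.exp (-|z.im|)) :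
    Integrable (fun y : ℝ => f (a + y * I)) ∧ Integrable (fun y : ℝ => f ((a + 1 : ℝ) + y * I)) ∧
    ∫ y : ℝ, f ((a + 1 : ℝ) + y * I) = ∫ y : ℝ, f (a + y * I) := by
  have int : ∀ x : ℝ, a ≤ x → x ≤ a + 1 → Integrable (fun y : ℝ => f (x + y * I)) := by
    intro x h1 h2
    refine Integrable.mono' (integrable_expabs.const_mul C) ?_ ?_
    · apply Continuous.aestronglyMeasurable
      rw [continuous_iff_continuousAt]
      intro y
      have := (hd (x + y * I) (by simpa using h1) (by simpa using h2)).continuousAt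
      exact ContinuousAt.comp (g := f) this (by fun_prop)
    · refine Filter.Eventually.of_forall fun y => ?_
      simpa using hb (x + y * I) (by simpa using h1) (by simpa using h2)
  have i1 := int a le_rfl (by linarith)
  have i2 := int (a + 1) (by linarith) le_rfl
  refine ⟨i1, i2, ?_⟩
  have l1 := intervalIntegral_tendsto_integral i1 Filter.tendsto_neg_atTop_atBot Filter.tendsto_id
  have l2 := intervalIntegral_tendsto_integral i2 Filter.tendsto_neg_atTop_atBot Filter.tendsto_id
  have hh : ∀ T : ℝ, ‖∫ x in a..(a+1), f (x + T * I)‖ ≤ C * Real.exp (-|T|) := by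
    intro T
    have := intervalIntegral.norm_integral_le_of_norm_le_const (a := a) (b := a + 1)
      (f := fun x : ℝ => f (x + T * I)) (C := C * Real.exp (-|T|)) (by
        intro x hx
        rw [Set.uIoc_of_le (by linarith)] at hx
        simpa using hb (x + T * I) (by simpa using hx.1.le) (by simpa using hx.2))
    simpa using this
  have e : ∀ T : ℝ, (∫ y in (-T)..T, f ((a + 1 : ℝ) + y * I)) - (∫ y in (-T)..T, f (a + y * I)) =
      I * ((∫ x in a..(a+1), f (x + (-T : ℝ) * I)) - (∫ x in a..(a+1), f (x + T * I))) := by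
    intro T
    have := Complex.integral_boundary_rect_eq_zero_of_differentiableOn f (⟨a, -T⟩) (⟨a + 1, T⟩) (by
      intro z hz
      rw [Complex.mem_reProdIm] at hz
      simp only at hz
      rw [Set.uIcc_of_le (by linarith)] at hz
      exact (hd z hz.1.1 hz.1.2).differentiableWithinAt)
    simp only [smul_eq_mul] at this
    generalize (∫ y in (-T)..T, f ((a + 1 : ℝ) + y * I)) = p at *
    generalize (∫ y in (-T)..T, f (a + y * I)) = q at *
    linear_combination (-I) * this + (p - q) * I_sq
  have lim0 : Filter.Tendsto (fun T : ℝ => C * Real.exp (-|T|) + C * Real.exp (-|T|)) Filter.atTop (nhds 0) := by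
    have : Filter.Tendsto (fun T : ℝ => Real.exp (-|T|)) Filter.atTop (nhds 0) :=
      Real.tendsto_exp_neg_atTop_nhds_zero.comp Filter.tendsto_abs_atTop_atTop
    simpa using (this.const_mul C).add (this.const_mul C)
  have lim : Filter.Tendsto (fun T : ℝ => (∫ y in (-T)..T, f ((a + 1 : ℝ) + y * I)) - (∫ y in (-T)..T, f (a + y * I)))
      Filter.atTop (nhds 0) := by
    refine squeeze_zero_norm ?_ lim0
    intro T
    rw [e T, norm_mul, Complex.norm_I, one_mul]
    refine (norm_sub_le _ _).trans (add_le_add ?_ (hh T))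
    simpa using hh (-T)
  have := tendsto_nhds_unique lim (l2.sub l1)
  exact (sub_eq_zero.mp this.symm)

lemma Gamma_diffAt {z : ℂ} (h : 0 < z.re) : DifferentiableAt ℂ Complex.Gamma z := by
  apply Complex.differentiableAt_Gamma
  intro m hm
  rw [hm] at h
  simp at h
  have : (0:ℝ) ≤ m := Nat.cast_nonneg m
  linarith

lemma HH_diff (m : ℕ) (t : ℂ) (h1 : -1/4 < t.re) : DifferentiableAt ℂ (HH m) t := by
  have hm : (0:ℝ) ≤ m := Nat.cast_nonneg m
  unfold HH
  refine DifferentiableAt.div ?_ (DifferentiableAt.mul ?_ ?_) ?_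
  · exact DifferentiableAt.comp (g := Complex.Gamma) t (Gamma_diffAt (by simp; linarith)) (by fun_prop)
  · exact DifferentiableAt.comp (g := Complex.Gamma) t (Gamma_diffAt (by simp; linarith)) (by fun_prop)
  · exact DifferentiableAt.comp (g := Complex.Gamma) t (Gamma_diffAt (by simp; linarith)) (by fun_prop)
  · exact mul_ne_zero (Complex.Gamma_ne_zero_of_re_pos (by simp; linarith))
      (Complex.Gamma_ne_zero_of_re_pos (by simp; linarith))

lemma HR_cont (m : ℕ) (x : ℝ) (h1 : -1/4 < x) : ContinuousAt (HR m) x := by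
  have h := ((HH_diff m x (by simpa using h1)).continuousAt)
  have h2 : ContinuousAt (fun y : ℝ => HH m y) x :=
    ContinuousAt.comp (g := HH m) h Complex.continuous_ofReal.continuousAt
  have h3 : ContinuousAt (fun y : ℝ => (HH m y).re) x := 
    ContinuousAt.comp (g := Complex.re) Complex.continuous_re.continuousAt h2
  refine h3.congr (Filter.Eventually.of_forall fun y => ?_)
  simp [HH_ofReal]

lemma GG_diff (m : ℕ) (t : ℂ) (h1 : -1/4 < t.re) (h2 : t.re < 1) : DifferentiableAt ℂ (GG m) t := by
  have hm : (0:ℝ) ≤ m := Nat.cast_nonneg m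
  have a1 : DifferentiableAt ℂ (fun t : ℂ => Complex.Gamma (t + 1/2)) t :=
    DifferentiableAt.comp (g := Complex.Gamma) t (Gamma_diffAt (by simp; linarith)) (by fun_prop)
  have a2 : DifferentiableAt ℂ (fun t : ℂ => Complex.Gamma (1 - t)) t :=
    DifferentiableAt.comp (g := Complex.Gamma) t (Gamma_diffAt (by simp; linarith)) (by fun_prop)
  have a3 := HH_diff m t h1
  have a4 := cpowR_differentiable (4/9) t
  have a5 : t + 1 + 2 * m ≠ 0 := re_ne (by simp; linarith)
  unfold GG
  exact (((((a1.mul a2).mul a3).div (by fun_prop) a5).mul a4).mul (by fun_prop)).mul (by fun_prop)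

lemma FF_diff (m : ℕ) (t : ℂ) (h1 : -1/4 < t.re) (h2 : t.re < 0) : DifferentiableAt ℂ (FF m) t := by
  have a1 : DifferentiableAt ℂ (fun t : ℂ => Complex.Gamma (t + 1/2)) t :=
    DifferentiableAt.comp (g := Complex.Gamma) t (Gamma_diffAt (by simp; linarith)) (by fun_prop)
  have a2 : DifferentiableAt ℂ (fun t : ℂ => Complex.Gamma (-t)) t :=
    DifferentiableAt.comp (g := Complex.Gamma) t (Gamma_diffAt (by simp; linarith)) (by fun_prop)
  have a3 := HH_diff m t h1
  have a4 := cpowR_differentiable (4/9) t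
  unfold FF
  exact ((((a1.mul a2).mul a3).mul a4).mul (by fun_prop)).mul (by fun_prop)

/-- the uniform majorant of `FF` on the line -/
lemma FF_bound (m : ℕ) (t : ℂ) (h1 : -1/4 < t.re) (h2 : t.re < 0) :
    ‖FF m t‖ ≤ (Real.Gamma (t.re + 1/2) * Real.Gamma (-t.re) * Real.exp (t.re * Real.log (4/9)) * 10368)
      * (HR m t.re * (4/27) ^ m * (1 + 6 * m)) * Real.exp (-|t.im|) := by
  have hm : (0:ℝ) ≤ m := Nat.cast_nonneg m
  have b1 := gamma_upper0 (t + 1/2) (by simp; linarith) (by simp; linarith)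
  have b2 := gamma_upper0 (-t) (by simp; linarith) (by simp; linarith)
  have b3 := HH_bound m t h1
  have b4 := kap_le t.im
  have k := kap_pos t.im
  have e1 : (t + 1/2).re = t.re + 1/2 := by simp
  have e2 : (t + 1/2).im = t.im := by simp
  have e3 : kap (-t).im = kap t.im := by simp [kap]
  rw [e1, e2] at b1
  rw [e3, Complex.neg_re] at b2
  have g1 := Real.Gamma_pos_of_pos (s := t.re + 1/2) (by linarith)
  have g2 := Real.Gamma_pos_of_pos (s := -t.re) (by linarith)
  have g3 := HR_pos m t.re h1
  have ht : ‖t‖ ≤ 1/4 + |t.im| := by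
    refine (Complex.norm_le_abs_re_add_abs_im t).trans ?_
    gcongr
    rw [abs_le]; constructor <;> linarith
  have b5 : ‖5 * t + 1 + 6 * m‖ ≤ 3 * (1 + 2 * |t.im|) * (1 + 6 * m) := by
    have : ‖5 * t + 1 + 6 * m‖ ≤ 5 * ‖t‖ + 1 + 6 * m := by
      refine (norm_add_le _ _).trans ?_
      refine (add_le_add (norm_add_le _ _) le_rfl).trans ?_
      simp
    have h0 := abs_nonneg t.im
    nlinarith [mul_nonneg h0 hm]
  have h0 := abs_nonneg t.im
  have b6 : ‖HH m t‖ ≤ HR m t.re / kap t.im := by rwa [le_div_iff₀ k]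
  have key : kap t.im * (1 + 2 * |t.im|) ≤ 3456 * Real.exp (-|t.im|) := by
    refine le_trans ?_ b4
    gcongr
    exact le_self_pow₀ (by linarith) (by norm_num)
  unfold FF
  simp only [norm_mul, cpowR_norm, norm_pow]
  rw [show ‖(4/27:ℂ)‖ = 4/27 by simp]
  have ex := Real.exp_pos (t.re * Real.log (4/9))
  calc _ ≤ (Real.Gamma (t.re + 1/2) * kap t.im) * (Real.Gamma (-t.re) * kap t.im) * (HR m t.re / kap t.im)
        * Real.exp (t.re * Real.log (4/9)) * (4/27) ^ m * (3 * (1 + 2 * |t.im|) * (1 + 6 * m)) := by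
        gcongr
    _ = (Real.Gamma (t.re + 1/2) * Real.Gamma (-t.re) * Real.exp (t.re * Real.log (4/9)) * 3)
      * (HR m t.re * (4/27) ^ m * (1 + 6 * m)) * (kap t.im * (1 + 2 * |t.im|)) := by
        field_simp
    _ ≤ (Real.Gamma (t.re + 1/2) * Real.Gamma (-t.re) * Real.exp (t.re * Real.log (4/9)) * 3)
      * (HR m t.re * (4/27) ^ m * (1 + 6 * m)) * (3456 * Real.exp (-|t.im|)) := by
        gcongr
    _ = _ := by ring

lemma GG_bound (m : ℕ) (t : ℂ) (h1 : -1/4 < t.re) (h2 : t.re < 1) :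
    ‖GG m t‖ ≤ (Real.Gamma (t.re + 1/2) * Real.Gamma (1 - t.re) * HR m t.re
      * Real.exp (t.re * Real.log (4/9))) * 100000 * Real.exp (-|t.im|) := by
  have hm : (0:ℝ) ≤ m := Nat.cast_nonneg m
  have b1 := gamma_upper1 (t + 1/2) (by simp; linarith) (by simp; linarith)
  have b2 := gamma_upper1 (1 - t) (by simp; linarith) (by simp; linarith)
  have b3 := HH_bound m t h1
  have b4 := kap_le t.im
  have k := kap_pos t.im
  have e1 : (t + 1/2).re = t.re + 1/2 := by simp
  have e2 : (t + 1/2).im = t.im := by simp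
  have e3 : kap (1 - t).im = kap t.im := by simp [kap]
  have e4 : |(1 - t).im| = |t.im| := by simp
  have e5 : (1 - t).re = 1 - t.re := by simp
  rw [e1, e2] at b1
  rw [e3, e4, e5] at b2
  have g1 := Real.Gamma_pos_of_pos (s := t.re + 1/2) (by linarith)
  have g2 := Real.Gamma_pos_of_pos (s := 1 - t.re) (by linarith)
  have g3 := HR_pos m t.re h1
  have h0 := abs_nonneg t.im
  have b5 : ‖(t - 2) / 3‖ ≤ 1 + 2 * |t.im| := by
    rw [norm_div]
    have : ‖t - 2‖ ≤ |(t-2).re| + |(t-2).im| := Complex.norm_le_abs_re_add_abs_im _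
    have h3 : |(t-2).re| ≤ 3 := by
      simp only [Complex.sub_re, Complex.re_ofNat]
      rw [abs_le]; constructor <;> linarith
    have h4 : (t-2).im = t.im := by simp
    rw [h4] at this
    rw [show ‖(3:ℂ)‖ = 3 by simp, div_le_iff₀ (by norm_num)]
    linarith
  have b6 : ‖HH m t‖ ≤ HR m t.re / kap t.im := by rwa [le_div_iff₀ k]
  have b7 : 3/4 ≤ ‖t + 1 + 2 * m‖ := by
    refine le_trans ?_ (Complex.re_le_norm _)
    simp; linarith
  have b8 : ((4:ℝ)/27) ^ m ≤ 1 := pow_le_one₀ (by norm_num) (by norm_num)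
  unfold GG
  simp only [norm_mul, cpowR_norm, norm_pow, norm_div _ (t + 1 + 2 * m)]
  rw [show ‖(4/27:ℂ)‖ = 4/27 by simp]
  have ex := Real.exp_pos (t.re * Real.log (4/9))
  calc _ ≤ (Real.Gamma (t.re + 1/2) * ((1 + 2 * |t.im|) * kap t.im)) * 
          (Real.Gamma (1 - t.re) * ((1 + 2 * |t.im|) * kap t.im)) * (HR m t.re / kap t.im) / (3/4)
        * Real.exp (t.re * Real.log (4/9)) * 1 * (1 + 2 * |t.im|) := by
        gcongr
    _ = (Real.Gamma (t.re + 1/2) * Real.Gamma (1 - t.re) * HR m t.re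
      * Real.exp (t.re * Real.log (4/9))) * (4/3) * (kap t.im * (1 + 2 * |t.im|) ^ 3) := by
        field_simp
    _ ≤ (Real.Gamma (t.re + 1/2) * Real.Gamma (1 - t.re) * HR m t.re
      * Real.exp (t.re * Real.log (4/9))) * (4/3) * (3456 * Real.exp (-|t.im|)) := by
        gcongr
    _ = (Real.Gamma (t.re + 1/2) * Real.Gamma (1 - t.re) * HR m t.re
      * Real.exp (t.re * Real.log (4/9))) * 4608 * Real.exp (-|t.im|) := by ring
    _ ≤ _ := by
        gcongr
        norm_num

lemma FF_int (c : ℝ) (hc1 : -1/4 < c) (hc2 : c < 0) (m : ℕ) :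
    Integrable (fun y : ℝ => FF m (c + y * I)) := by
  refine Integrable.mono' (integrable_expabs.const_mul
    ((Real.Gamma (c + 1/2) * Real.Gamma (-c) * Real.exp (c * Real.log (4/9)) * 10368)
      * (HR m c * (4/27) ^ m * (1 + 6 * m)))) ?_ ?_
  · apply Continuous.aestronglyMeasurable
    rw [continuous_iff_continuousAt]
    intro y
    have := (FF_diff m (c + y * I) (by simpa using hc1) (by simpa using hc2)).continuousAt
    exact ContinuousAt.comp (g := FF m) this (by fun_prop)
  · refine Filter.Eventually.of_forall fun y => ?_
    simpa using FF_bound m (c + y * I) (by simpa using hc1) (by simpa using hc2)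

lemma FF_step (c : ℝ) (hc1 : -1/4 < c) (hc2 : c < 0) (m : ℕ) :
    ∫ y : ℝ, FF (m+1) (c + y * I) = ∫ y : ℝ, FF m (c + y * I) := by
  have hcont : ContinuousOn (fun x : ℝ => Real.Gamma (x + 1/2) * Real.Gamma (1 - x) * HR m x
      * Real.exp (x * Real.log (4/9))) (Set.Icc c (c+1)) := by
    intro x hx
    apply ContinuousAt.continuousWithinAt
    have gc : ∀ s : ℝ, 0 < s → ContinuousAt Real.Gamma s := fun s hs =>
      (Real.differentiableAt_Gamma (fun k hk => by
        have : (0:ℝ) ≤ k := Nat.cast_nonneg k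
        linarith)).continuousAt
    have a1 : ContinuousAt (fun x : ℝ => Real.Gamma (x + 1/2)) x :=
      ContinuousAt.comp (g := Real.Gamma) (gc _ (by linarith [hx.1])) (by fun_prop)
    have a2 : ContinuousAt (fun x : ℝ => Real.Gamma (1 - x)) x :=
      ContinuousAt.comp (g := Real.Gamma) (gc _ (by linarith [hx.2])) (by fun_prop)
    have a3 := HR_cont m x (by linarith [hx.1])
    exact ((a1.mul a2).mul a3).mul (by fun_prop)
  obtain ⟨B, hB⟩ := isCompact_Icc.exists_bound_of_continuousOn hcont
  obtain ⟨i1, i2, e⟩ := shift (GG m) c (B * 100000)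
    (fun z h1 h2 => GG_diff m z (by linarith) (by linarith))
    (fun z h1 h2 => by
      refine (GG_bound m z (by linarith) (by linarith)).trans ?_
      gcongr
      exact (le_abs_self _).trans (hB z.re ⟨h1, h2⟩))
  rw [← sub_eq_zero, ← integral_sub (FF_int c hc1 hc2 _) (FF_int c hc1 hc2 _)]
  rw [← sub_eq_zero, ← integral_sub i2 i1] at e
  rw [← e]
  congr 1
  ext y
  rw [wz m _ (by simpa using hc1) (by simpa using hc2)]
  congr 2
  push_cast
  ring

lemma FF_const (c : ℝ) (hc1 : -1/4 < c) (hc2 : c < 0) (m : ℕ) :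
    ∫ y : ℝ, FF m (c + y * I) = ∫ y : ℝ, FF 0 (c + y * I) := by
  induction m with
  | zero => rfl
  | succ k ih => rw [FF_step c hc1 hc2, ih]

lemma Gamma_prod (s : ℂ) (hs : ∀ k : ℕ, s ≠ -k) (n : ℕ) :
    Complex.Gamma (s + n) = Complex.Gamma s * ∏ j ∈ Finset.range n, (s + j) := by
  induction n with
  | zero => simp
  | succ n ih =>
    have h : s + n ≠ 0 := fun h => hs n (by linear_combination h)
    rw [Finset.prod_range_succ, show s + ((n+1 : ℕ) : ℂ) = (s + n) + 1 by push_cast; ring,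
      Complex.Gamma_add_one _ h, ih]
    ring

noncomputable def eS (s : ℂ) (n : ℕ) : ℂ :=
  Complex.Gamma (s + n + 1) / ((n:ℂ) ^ s * (n.factorial : ℂ))

lemma eS_lim (s : ℂ) (hs : ∀ k : ℕ, s ≠ -k) :
    Filter.Tendsto (eS s) Filter.atTop (nhds 1) := by
  have h := Complex.GammaSeq_tendsto_Gamma s
  have g := Complex.Gamma_ne_zero hs
  have h2 := (h.const_mul (Complex.Gamma s)⁻¹).inv₀ (by simp [g])
  rw [inv_mul_cancel₀ g, inv_one] at h2
  refine h2.congr fun n => ?_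
  unfold eS Complex.GammaSeq
  have := Gamma_prod s hs (n+1)
  push_cast at this
  rw [← add_assoc] at this
  rw [this]
  simp only [mul_inv, inv_inv, inv_div]
  rw [mul_div_assoc]

lemma stirl (m : ℕ) (hm : m ≠ 0) :
    ((3*m).factorial : ℝ) / (m.factorial * (2*m).factorial) * (4/27)^m * (6 * m) / √(3*m) =
      3 * (Stirling.stirlingSeq (3*m) / (Stirling.stirlingSeq m * Stirling.stirlingSeq (2*m))) := by
  have hm' : (0:ℝ) < m := by positivity
  have key : ∀ n : ℕ, n ≠ 0 → (n.factorial : ℝ) = Stirling.stirlingSeq n * (√(2*n) * (n / Real.exp 1)^n) := by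
    intro n hn
    have : (0:ℝ) < n := by positivity
    unfold Stirling.stirlingSeq
    field_simp
  have p : ∀ n : ℕ, n ≠ 0 → 0 < Stirling.stirlingSeq n := by
    intro n hn
    obtain ⟨k, rfl⟩ := Nat.exists_eq_succ_of_ne_zero hn
    exact Stirling.stirlingSeq'_pos k
  have p1 := p m hm
  have p2 := p (2*m) (by omega)
  have p3 := p (3*m) (by omega)
  rw [key m hm, key (2*m) (by omega), key (3*m) (by omega)]
  generalize Stirling.stirlingSeq m = A at *
  generalize Stirling.stirlingSeq (2*m) = B at *
  generalize Stirling.stirlingSeq (3*m) = C at *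
  push_cast
  have e1 : √(2 * (3 * (m:ℝ))) = √6 * √m := by rw [← Real.sqrt_mul (by norm_num)]; congr 1; ring
  have e2 : √(2 * (2 * (m:ℝ))) = 2 * √m := by
    rw [show (2 * (2 * (m:ℝ))) = 2 ^ 2 * m by ring, Real.sqrt_mul (by norm_num), Real.sqrt_sq (by norm_num)]
  have e3 : √(2 * (m:ℝ)) = √2 * √m := Real.sqrt_mul (by norm_num) _
  have e4 : √(3 * (m:ℝ)) = √3 * √m := Real.sqrt_mul (by norm_num) _
  have e5 : √6 = √2 * √3 := by rw [← Real.sqrt_mul (by norm_num)]; congr 1; norm_num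
  have q : (3 * (m:ℝ) / Real.exp 1) ^ (3 * m) * (4/27)^m = (m / Real.exp 1)^m * (2 * m / Real.exp 1) ^ (2*m) := by
    rw [pow_mul, pow_mul, ← mul_pow, ← mul_pow]
    congr 1
    field_simp
    ring
  have sm : √(m:ℝ) * √m = m := Real.mul_self_sqrt hm'.le
  have sm0 : 0 < √(m:ℝ) := Real.sqrt_pos.mpr hm'
  have X1 : 0 < ((m:ℝ) / Real.exp 1)^m := by positivity
  have X2 : 0 < (2 * (m:ℝ) / Real.exp 1)^(2*m) := by positivity
  rw [e1, e2, e3, e4, e5]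
  generalize (3 * (m:ℝ) / Real.exp 1) ^ (3 * m) = U at *
  generalize ((m:ℝ) / Real.exp 1)^m = V at *
  generalize (2 * (m:ℝ) / Real.exp 1)^(2*m) = W at *
  generalize ((4:ℝ)/27)^m = Y at *
  generalize √(m:ℝ) = r at *
  rw [← sm]
  field_simp
  linear_combination 6 * q

lemma HH_lim (t : ℂ) (h1 : -1/4 < t.re) (h2 : t.re < 0) (d : ℂ) :
    Filter.Tendsto (fun m : ℕ => HH m t * (4/27)^m * (d + 6 * m)) Filter.atTop
      (nhds (cpowR (9/2) t * ((3 / √π : ℝ) : ℂ))) := by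
  have nz : ∀ k : ℕ, t ≠ -k := by
    rintro k rfl
    simp at h1 h2
    have : (k:ℝ) < 1 := by linarith
    have : k < 1 := by exact_mod_cast this
    omega
  have nz2 : ∀ k : ℕ, 2 * t - 1/2 ≠ -k := by
    intro k hk
    have := congrArg Complex.re hk
    simp at this
    have h3 : (0:ℝ) < k := by linarith
    have h4 : (k:ℝ) < 1 := by linarith
    have h3 : 0 < k := by exact_mod_cast h3
    have h4 : k < 1 := by exact_mod_cast h4
    omega
  have t3 : Filter.Tendsto (fun m : ℕ => 3 * m) Filter.atTop Filter.atTop :=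
    Filter.tendsto_atTop_mono (fun m => by show m ≤ _; omega) Filter.tendsto_id
  have t2 : Filter.Tendsto (fun m : ℕ => 2 * m) Filter.atTop Filter.atTop :=
    Filter.tendsto_atTop_mono (fun m => by show m ≤ _; omega) Filter.tendsto_id
  have l1 := (eS_lim _ nz2).comp t3
  have l2 := eS_lim _ nz
  have l3 := (eS_lim _ nz).comp t2
  have lA := l1.div (l2.mul l3) (by norm_num)
  have S := Stirling.tendsto_stirlingSeq_sqrt_pi
  have sp := sqrt_pi_pos
  have lS := ((S.comp t3).div (S.mul (S.comp t2)) (by positivity)).const_mul 3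
  have lS' := (Complex.continuous_ofReal.tendsto _).comp lS
  have lD : Filter.Tendsto (fun m : ℕ => (d + 6 * m) / (6 * m)) Filter.atTop (nhds (1:ℂ)) := by
    have h : Filter.Tendsto (fun m : ℕ => d / 6 * ((m:ℂ))⁻¹ + 1) Filter.atTop (nhds (d / 6 * 0 + 1)) :=
      (tendsto_inv_atTop_nhds_zero_nat.const_mul _).add_const _
    rw [mul_zero, zero_add] at h
    refine h.congr' ?_
    filter_upwards [Filter.eventually_ne_atTop 0] with m hm
    have : (m:ℂ) ≠ 0 := by exact_mod_cast hm
    field_simp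
  have L := ((lA.mul lS').mul lD).const_mul (cpowR (9/2) t)
  have eL : cpowR (9/2) t * (1 / (1 * 1) * ((3 * (√π / (√π * √π)) : ℝ) : ℂ) * 1) =
      cpowR (9/2) t * ((3 / √π : ℝ) : ℂ) := by
    rw [show 3 * (√π / (√π * √π)) = 3 / √π by field_simp]
    ring
  rw [eL] at L
  refine L.congr' ?_
  filter_upwards [Filter.eventually_ne_atTop 0] with m hm
  have hm' : (0:ℝ) < m := by positivity
  have hmc : (m:ℂ) ≠ 0 := by exact_mod_cast hm
  simp only [Function.comp_apply, Pi.div_apply, Pi.mul_apply]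
  rw [← stirl m hm]
  have pw : ((3 * m : ℕ) : ℂ) ^ (2 * t - 1/2) * (√(3 * (m:ℝ)) : ℝ) =
      cpowR (9/2) t * ((m:ℂ)^t * ((2 * m : ℕ) : ℂ)^t) := by
    have c1 : ∀ n : ℕ, n ≠ 0 → ∀ s : ℂ, (n:ℂ) ^ s = Complex.exp (s * (Real.log n : ℝ)) := by
      intro n hn s
      rw [Complex.cpow_def_of_ne_zero (by exact_mod_cast hn), ← Complex.natCast_log, mul_comm]
    rw [c1 _ hm, c1 (3 * m) (by omega), c1 (2*m) (by omega)]
    rw [Real.sqrt_eq_rpow, Real.rpow_def_of_pos (by positivity)]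
    unfold cpowR
    push_cast
    rw [← Complex.exp_add, ← Complex.exp_add, ← Complex.exp_add]
    congr 1
    have r3 : Real.log (3 * m) = Real.log 3 + Real.log m := Real.log_mul (by norm_num) hm'.ne'
    have r2 : Real.log (2 * m) = Real.log 2 + Real.log m := Real.log_mul (by norm_num) hm'.ne'
    have r9 : Real.log (9 / 2) = 2 * Real.log 3 - Real.log 2 := by
      rw [Real.log_div (by norm_num) (by norm_num), show (9:ℝ) = 3 ^ 2 by norm_num, Real.log_pow]
      push_cast; ring
    rw [r3, r2, r9]
    push_cast
    ring
  have sq0 : ((√(3 * (m:ℝ)) : ℝ) : ℂ) ≠ 0 := by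
    have : 0 < √(3 * (m:ℝ)) := Real.sqrt_pos.mpr (by positivity)
    exact_mod_cast this.ne'
  have P1 : ((3 * m : ℕ) : ℂ) ^ (2 * t - 1/2) ≠ 0 := by
    rw [Complex.cpow_ne_zero_iff]; left; exact_mod_cast (by omega : 3 * m ≠ 0)
  have P2 : ((m : ℕ) : ℂ) ^ t ≠ 0 := by
    rw [Complex.cpow_ne_zero_iff]; left; exact hmc
  have P3 : ((2 * m : ℕ) : ℂ) ^ t ≠ 0 := by
    rw [Complex.cpow_ne_zero_iff]; left; exact_mod_cast (by omega : 2 * m ≠ 0)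
  have f1 : (((3 * m).factorial : ℕ) : ℂ) ≠ 0 := by exact_mod_cast (Nat.factorial_ne_zero _)
  have f2 : (((2 * m).factorial : ℕ) : ℂ) ≠ 0 := by exact_mod_cast (Nat.factorial_ne_zero _)
  have f3 : (((m).factorial : ℕ) : ℂ) ≠ 0 := by exact_mod_cast (Nat.factorial_ne_zero _)
  have gB : Complex.Gamma (t + 1 + m) ≠ 0 :=
    Complex.Gamma_ne_zero_of_re_pos (by simp; linarith)
  have gC : Complex.Gamma (t + 1 + 2 * m) ≠ 0 :=
    Complex.Gamma_ne_zero_of_re_pos (by simp; linarith)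
  unfold eS HH
  rw [show 2 * t - 1/2 + ((3 * m : ℕ) : ℂ) + 1 = 2 * t + 1/2 + 3 * m by push_cast; ring,
    show t + (m:ℂ) + 1 = t + 1 + m by ring,
    show t + ((2 * m : ℕ) : ℂ) + 1 = t + 1 + 2 * m by push_cast; ring]
  push_cast at pw P1 P3 ⊢
  generalize Complex.Gamma (2 * t + 1/2 + 3 * m) = A
  generalize Complex.Gamma (t + 1 + m) = B at *
  generalize Complex.Gamma (t + 1 + 2 * m) = C at *
  generalize (3 * (m:ℂ)) ^ (2 * t - 1/2) = D at *
  generalize (m:ℂ) ^ t = E at *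
  generalize (2 * (m:ℂ)) ^ t = F at *
  generalize ((√(3 * (m:ℝ)) : ℝ) : ℂ) = Q at *
  generalize cpowR (9/2) t = Z at *
  generalize ((4:ℂ)/27) ^ m = W
  field_simp
  linear_combination (-(A * W * (d + 6 * m))) * pw

lemma gam_int (σ : ℝ) (h0 : 0 < σ) (h1 : σ < 1/4) :
    Integrable (fun y : ℝ => Complex.Gamma (σ + y * I)) := by
  refine Integrable.mono' (integrable_expabs.const_mul (Real.Gamma σ * 3456)) ?_ ?_
  · refine Continuous.aestronglyMeasurable ?_
    rw [continuous_iff_continuousAt]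
    intro y
    have h : ContinuousAt Complex.Gamma ((σ:ℂ) + y * I) :=
      (Gamma_diffAt (by simpa using h0)).continuousAt
    exact ContinuousAt.comp (f := fun y : ℝ => (σ:ℂ) + y * I) h (by fun_prop)
  · refine Filter.Eventually.of_forall fun y => ?_
    have b := gamma_upper0 (σ + y * I) (by simpa using h0) (by simp; linarith)
    simp at b
    have k := kap_le y
    have kp := kap_pos y
    have g := Real.Gamma_pos_of_pos h0
    have : kap y ≤ 3456 * Real.exp (-|y|) := by
      refine le_trans ?_ k
      have : 1 ≤ (1 + 2 * |y|)^3 := one_le_pow₀ (by linarith [abs_nonneg y])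
      nlinarith
    calc _ ≤ _ := b
      _ ≤ _ := by rw [mul_assoc]; exact mul_le_mul_of_nonneg_left this g.le

lemma mel (σ : ℝ) (h0 : 0 < σ) (h1 : σ < 1/4) (x : ℝ) (hx : 0 < x) :
    ∫ y : ℝ, Complex.exp (-(σ + y * I) * Real.log x) * Complex.Gamma (σ + y * I) =
      2 * π * Real.exp (-x) := by
  have hm : ∀ y : ℝ, mellin (fun x : ℝ => ((Real.exp (-x) : ℝ) : ℂ)) (σ + y * I) = Complex.Gamma (σ + y * I) := by
    intro y
    rw [← Complex.GammaIntegral_eq_mellin, Complex.Gamma_eq_integral (by simpa using h0)]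
  have h := mellinInv_mellin_eq σ (fun x : ℝ => ((Real.exp (-x) : ℝ) : ℂ)) hx ?_ ?_ (by fun_prop)
  · unfold mellinInv at h
    simp only [hm] at h
    have pi0 : (π : ℂ) ≠ 0 := by exact_mod_cast Real.pi_ne_zero
    rw [← h]
    rw [Complex.real_smul]
    push_cast
    rw [← mul_assoc, show 2 * (π:ℂ) * (1 / (2 * π)) = 1 by field_simp, one_mul]
    congr 1
    ext y
    rw [smul_eq_mul, Complex.cpow_def_of_ne_zero (by exact_mod_cast hx.ne'), ← Complex.ofReal_log hx.le,
      mul_comm (Real.log x : ℂ)]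
  · have := Complex.GammaIntegral_convergent (s := σ) (by simpa using h0)
    refine this.congr ?_
    exact Filter.Eventually.of_forall fun u => by simp [mul_comm]
  · unfold VerticalIntegrable
    simp only [hm]
    exact gam_int σ h0 h1

lemma mel2 (c : ℝ) (hc1 : -1/4 < c) (hc2 : c < 0) :
    ∫ y : ℝ, Complex.Gamma ((c + y * I) + 1/2) * Complex.Gamma (-(c + y * I)) * cpowR 2 (c + y * I) =
      ((2 * π * √π / √3 : ℝ) : ℂ) := by
  obtain ⟨σ, rfl⟩ : ∃ σ, c = -σ := ⟨-c, by ring⟩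
  have h0 : 0 < σ := by linarith
  have h1 : σ < 1/4 := by linarith
  rw [← integral_neg_eq_self]
  set F : ℝ → ℂ := fun y => Complex.Gamma (σ + y * I) * cpowR 2 (-(σ + y * I)) with hF
  set G : ℝ → ℂ := fun u => ((Real.exp (-u) * u ^ (-1/2 - σ) : ℝ) : ℂ) with hG
  have iF : Integrable F := by
    refine (gam_int σ h0 h1).mul_bdd (c := Real.exp (-σ * Real.log 2)) ?_ ?_
    · refine Continuous.aestronglyMeasurable ?_
      unfold cpowR
      fun_prop
    · refine Filter.Eventually.of_forall fun y => ?_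
      rw [cpowR, Complex.norm_exp, Complex.re_mul_ofReal]
      simp
  have iG : Integrable G (volume.restrict (Set.Ioi 0)) := by
    have := Real.GammaIntegral_convergent (s := 1/2 - σ) (by linarith)
    rw [show 1/2 - σ - 1 = -1/2 - σ by ring] at this
    exact Integrable.ofReal this
  have iK : Integrable (fun p : ℝ × ℝ => F p.1 * G p.2 * Complex.exp (((-(p.1 * Real.log p.2) : ℝ) : ℂ) * I))
      (volume.prod (volume.restrict (Set.Ioi 0))) := by
    refine (iF.mul_prod iG).mul_bdd (c := 1) ?_ ?_
    · refine Measurable.aestronglyMeasurable ?_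
      fun_prop
    · refine Filter.Eventually.of_forall fun p => ?_
      rw [Complex.norm_exp_ofReal_mul_I]
  have sw := integral_integral_swap (f := fun y u => F y * G u * Complex.exp (((-(y * Real.log u) : ℝ) : ℂ) * I)) iK
  have e1 : ∀ y : ℝ, ∫ u in Set.Ioi (0:ℝ), F y * G u * Complex.exp (((-(y * Real.log u) : ℝ) : ℂ) * I) =
      Complex.Gamma ((((-σ : ℝ):ℂ) + ((-y : ℝ):ℂ) * I) + 1/2) * Complex.Gamma (-(((-σ : ℝ):ℂ) + ((-y : ℝ):ℂ) * I)) * cpowR 2 (((-σ : ℝ):ℂ) + ((-y : ℝ):ℂ) * I) := by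
    intro y
    have : Complex.Gamma ((((-σ : ℝ):ℂ) + ((-y : ℝ):ℂ) * I) + 1/2) =
        ∫ u in Set.Ioi (0:ℝ), G u * Complex.exp (((-(y * Real.log u) : ℝ) : ℂ) * I) := by
      rw [Complex.Gamma_eq_integral (by simp; linarith), Complex.GammaIntegral]
      refine setIntegral_congr_fun measurableSet_Ioi fun u hu => ?_
      have hu : 0 < u := hu
      simp only [hG]
      rw [Complex.cpow_def_of_ne_zero (by exact_mod_cast hu.ne'), ← Complex.ofReal_log hu.le,
        Real.rpow_def_of_pos hu]
      push_cast
      conv_rhs => rw [mul_assoc, ← Complex.exp_add]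
      congr 2
      ring
    rw [this]
    simp only [mul_assoc, hF]
    rw [integral_const_mul, integral_const_mul]
    rw [show -(((-σ : ℝ):ℂ) + ((-y : ℝ):ℂ) * I) = σ + y * I by push_cast; ring,
      show (((-σ : ℝ):ℂ) + ((-y : ℝ):ℂ) * I) = -(σ + y * I) by push_cast; ring]
    ring
  have e2 : ∀ u ∈ Set.Ioi (0:ℝ), ∫ y : ℝ, F y * G u * Complex.exp (((-(y * Real.log u) : ℝ) : ℂ) * I) =
      ((2 * π * (u ^ ((1/2 : ℝ) - 1) * Real.exp (-(3 * u))) : ℝ) : ℂ) := by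
    intro u hu
    have hu : 0 < u := hu
    have m := mel σ h0 h1 (2 * u) (by positivity)
    have : ∀ y : ℝ, F y * G u * Complex.exp (((-(y * Real.log u) : ℝ) : ℂ) * I) =
        ((Real.exp (-u) * u ^ ((1/2 : ℝ) - 1) : ℝ) : ℂ) *
          (Complex.exp (-(σ + y * I) * Real.log (2 * u)) * Complex.Gamma (σ + y * I)) := by
      intro y
      simp only [hF, hG, cpowR]
      rw [Real.rpow_def_of_pos hu, Real.rpow_def_of_pos hu, Real.log_mul (by norm_num) hu.ne']
      push_cast
      have : Complex.exp (-(σ + y * I) * Real.log 2) * Complex.exp (Real.log u * (-1/2 - σ)) * Complex.exp (-(y * Real.log u) * I) = Complex.exp (Real.log u * (1/2 - 1)) * Complex.exp (-(σ + y * I) * (Real.log 2 + Real.log u)) := by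
        rw [← Complex.exp_add, ← Complex.exp_add, ← Complex.exp_add]
        congr 1
        ring
      linear_combination (Complex.exp (-u) * Complex.Gamma (σ + y * I)) * this
    simp only [this]
    rw [integral_const_mul, m]
    have : Real.exp (-(3 * u)) = Real.exp (-u) * Real.exp (-(2 * u)) := by
      rw [← Real.exp_add]; congr 1; ring
    rw [this]
    push_cast
    ring
  simp only [e1] at sw
  rw [sw, setIntegral_congr_fun measurableSet_Ioi e2, integral_complex_ofReal, integral_const_mul,
    Real.integral_rpow_mul_exp_neg_mul_Ioi (by norm_num) (by norm_num), Real.Gamma_one_half_eq,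
    ← Real.sqrt_eq_rpow, Real.sqrt_div (by norm_num), Real.sqrt_one]
  congr 1
  ring

lemma FF_zero_val (c : ℝ) (hc1 : -1/4 < c) (hc2 : c < 0) :
    ∫ y : ℝ, FF 0 (c + y * I) = ((2 * π * √3 : ℝ) : ℂ) := by
  have sp := sqrt_pi_pos
  -- boundedness of the real sequence
  have hb : ∃ B : ℝ, ∀ m : ℕ, HR m c * (4/27)^m * (1 + 6 * m) ≤ B := by
    have h := (HH_lim (c:ℂ) (by simpa using hc1) (by simpa using hc2) 1).norm
    obtain ⟨B, hB⟩ := h.bddAbove_range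
    refine ⟨B, fun m => ?_⟩
    have := hB ⟨m, rfl⟩
    refine le_trans (le_of_eq ?_) this
    simp only []
    rw [HH_ofReal]
    have e : ((HR m c : ℝ) : ℂ) * (4/27)^m * (1 + 6 * m) = ((HR m c * (4/27)^m * (1 + 6 * m) : ℝ) : ℂ) := by
      push_cast; ring
    rw [e, Complex.norm_real, Real.norm_of_nonneg]
    have := HR_pos m c hc1
    positivity
  obtain ⟨B, hB⟩ := hb
  have g1 := Real.Gamma_pos_of_pos (show 0 < c + 1/2 by linarith)
  have g2 := Real.Gamma_pos_of_pos (show 0 < -c by linarith)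
  have lim := tendsto_integral_of_dominated_convergence
    (F := fun (m : ℕ) (y : ℝ) => FF m (c + y * I))
    (f := fun y : ℝ => ((3 / √π : ℝ) : ℂ) * (Complex.Gamma ((c + y * I) + 1/2) * Complex.Gamma (-(c + y * I)) * cpowR 2 (c + y * I)))
    (μ := volume)
    (fun y : ℝ => (Real.Gamma (c + 1/2) * Real.Gamma (-c) * Real.exp (c * Real.log (4/9)) * 10368) * B * Real.exp (-|y|))
    (fun m => (FF_int c hc1 hc2 m).aestronglyMeasurable)
    (integrable_expabs.const_mul _)
    (fun m => Filter.Eventually.of_forall fun y => by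
      have b := FF_bound m (c + y * I) (by simpa using hc1) (by simpa using hc2)
      have r : ((c:ℂ) + y * I).re = c := by simp
      have i : ((c:ℂ) + y * I).im = y := by simp
      rw [r, i] at b
      refine b.trans ?_
      have := hB m
      gcongr)
    (Filter.Eventually.of_forall fun y => by
      set t : ℂ := c + y * I with ht
      have r : t.re = c := by simp [ht]
      have h := (HH_lim t (by rw [r]; exact hc1) (by rw [r]; exact hc2) (5 * t + 1)).const_mul
        (Complex.Gamma (t + 1/2) * Complex.Gamma (-t) * cpowR (4/9) t)
      have e : cpowR (4/9) t * cpowR (9/2) t = cpowR 2 t := by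
        unfold cpowR
        rw [← Complex.exp_add, ← mul_add, ← Complex.ofReal_add, ← Real.log_mul (by norm_num) (by norm_num)]
        norm_num
      convert! h using 1
      · ext m
        simp only [FF]
        ring
      · rw [← e]
        congr 1
        ring)
  simp only [FF_const c hc1 hc2] at lim
  have h := tendsto_nhds_unique tendsto_const_nhds lim
  rw [h, integral_const_mul, mel2 c hc1 hc2, ← Complex.ofReal_mul]
  congr 1
  have : √3 * √3 = 3 := Real.mul_self_sqrt (by norm_num)
  have : 0 < √(3:ℝ) := by positivity
  field_simp
  linarith

lemma g2_eq (s : ℂ) : g2 s = (π : ℂ)⁻¹ * FF 0 s := by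
  have sp := sqrt_pi_pos
  have spc : ((√π : ℝ) : ℂ) ≠ 0 := by exact_mod_cast sp.ne'
  have pp : ((√π : ℝ) : ℂ) * ((√π : ℝ) : ℂ) = π := by
    rw [← Complex.ofReal_mul, Real.mul_self_sqrt Real.pi_pos.le]
  have gh : Complex.Gamma (1/2) = ((√π : ℝ) : ℂ) := by
    have := Complex.Gamma_ofReal (1/2)
    rw [Real.Gamma_one_half_eq] at this
    rw [← this]; norm_num
  have two : ∀ z : ℂ, (2:ℂ) ^ z = cpowR 2 z := by
    intro z
    rw [Complex.cpow_def_of_ne_zero (by norm_num), cpowR, mul_comm, Complex.ofReal_log (by norm_num)]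
    norm_num
  have d1 := Complex.Gamma_mul_Gamma_add_half (1/4 + s)
  have d2 := Complex.Gamma_mul_Gamma_add_half (1/4)
  rw [show (1/4 + s + 1/2 : ℂ) = 3/4 + s by ring, two, show 2 * (1/4 + s) = 2 * s + 1/2 by ring] at d1
  rw [show (1/4 + 1/2 : ℂ) = 3/4 by norm_num, two, show (2 * (1/4) : ℂ) = 1/2 by norm_num, gh] at d2
  have e : cpowR 2 (1 - (2 * s + 1/2)) * cpowR (4/3) (2 * s) = cpowR 2 (1 - 1/2) * cpowR (4/9) s := by
    unfold cpowR
    rw [← Complex.exp_add, ← Complex.exp_add]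
    congr 1
    have r1 : Real.log (4/3) = 2 * Real.log 2 - Real.log 3 := by
      rw [Real.log_div (by norm_num) (by norm_num), show (4:ℝ) = 2 ^ 2 by norm_num, Real.log_pow]
      push_cast; ring
    have r2 : Real.log (4/9) = 2 * Real.log 2 - 2 * Real.log 3 := by
      rw [Real.log_div (by norm_num) (by norm_num), show (4:ℝ) = 2 ^ 2 by norm_num,
        show (9:ℝ) = 3 ^ 2 by norm_num, Real.log_pow, Real.log_pow]
      push_cast; ring
    rw [r1, r2]; push_cast; ring
  have n0 : cpowR 2 (1 - 1/2) ≠ 0 := Complex.exp_ne_zero _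
  have q1 : Complex.Gamma (1/4) * Complex.Gamma (3/4) ≠ 0 := by
    rw [d2]; exact mul_ne_zero (mul_ne_zero spc n0) spc
  have key : Complex.Gamma (1/4 + s) * Complex.Gamma (3/4 + s) * cpowR (4/3) (2 * s) * ((√π : ℝ) : ℂ) =
      Complex.Gamma (2 * s + 1/2) * cpowR (4/9) s * (Complex.Gamma (1/4) * Complex.Gamma (3/4)) := by
    rw [d1, d2]
    linear_combination (Complex.Gamma (2 * s + 1/2) * ((√π : ℝ) : ℂ) * ((√π : ℝ) : ℂ)) * e
  unfold g2 cpoch FF HH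
  rw [gh, Complex.Gamma_one, ← pp, show (1/2 + s : ℂ) = s + 1/2 by ring, show (1 + s : ℂ) = s + 1 by ring]
  simp only [Nat.cast_zero, mul_zero, add_zero, pow_zero, mul_one, div_one]
  have a1 := left_ne_zero_of_mul q1
  have a2 := right_ne_zero_of_mul q1
  have k2 : Complex.Gamma (1/4 + s) / Complex.Gamma (1/4) * (Complex.Gamma (3/4 + s) / Complex.Gamma (3/4)) * cpowR (4/3) (2 * s) =
      Complex.Gamma (2 * s + 1/2) * cpowR (4/9) s / ((√π : ℝ) : ℂ) := by
    rw [eq_div_iff spc, div_mul_div_comm, div_mul_eq_mul_div, div_mul_eq_mul_div, div_eq_iff q1]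
    exact key
  rw [mul_inv]
  simp only [div_eq_mul_inv] at k2 ⊢
  linear_combination (Complex.Gamma (s + 1 * 2⁻¹) * (((√π : ℝ) : ℂ))⁻¹ * ((Complex.Gamma (s+1))^2)⁻¹ * (5 * s + 1) * Complex.Gamma (-s)) * k2

theorem barnes_integral_sqrt3_over_pi (c : ℝ) (hc1 : -1/4 < c) (hc2 : c < 0) :
    Integrable (fun y : ℝ => g2 ((c : ℂ) + (y : ℂ) * Complex.I)) ∧
    (1 / (2*(π : ℂ))) * ∫ y : ℝ, g2 ((c : ℂ) + (y : ℂ) * Complex.I) =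
      (Real.sqrt 3 / π : ℝ) := by
  simp only [g2_eq]
  refine ⟨(FF_int c hc1 hc2 0).const_mul _, ?_⟩
  rw [integral_const_mul, FF_zero_val c hc1 hc2]
  have pi0 : (π : ℂ) ≠ 0 := by exact_mod_cast Real.pi_ne_zero
  push_cast
  field_simp
end
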